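/- arXiv:2605.31583 — 2 statements merged into one kernel-verified Lean document; each statement's English description precedes it below -/
import Mathlib

section
/- Let α > 0 and δ > 0 be fixed with α + δ ≤ 1/2, and set A*(δ, α; n) = min{ n^{-(1-α-δ)}, √(4(1+δ)α (log n)/n) }. Then the minimax risk satisfies lim_{n→∞} (log R_n(A*(δ, α; n))) / n^{2δ} = −1/8. -/
open MeasureTheory ProbabilityTheory Real Filter Topology

noncomputable section

/-- Law of the N×N Gaussian observation matrix with mean matrix θ and unit variances. -/
def PTheta (N : ℕ) (θ : Fin N → Fin N → ℝ) : Measure (Fin N → Fin N → ℝ) :=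
  Measure.pi fun i => Measure.pi fun j => gaussianReal (θ i j) 1

/-- Parameter space Θ(A, n, N). -/
def ThetaSet (A : ℝ) (n N : ℕ) : Set (Fin N → Fin N → ℝ) :=
  {θ | ∃ R C : Finset (Fin N), R.card = n ∧ C.card = n ∧
    (∀ i j, i ∈ R → j ∈ C → A ≤ θ i j) ∧
    (∀ i j, ¬(i ∈ R ∧ j ∈ C) → θ i j = 0)}

/-- Risk of the test with rejection region `T`: type-I error plus worst-case type-II error. -/
def testRisk (n N : ℕ) (A : ℝ) (T : Set (Fin N → Fin N → ℝ)) : ℝ :=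
  (PTheta N 0 T).toReal + ⨆ θ : ThetaSet A n N, (PTheta N θ.1 Tᶜ).toReal

/-- Minimax risk over all (measurable) tests. -/
def minimaxRisk (n N : ℕ) (A : ℝ) : ℝ :=
  ⨅ T : {T : Set (Fin N → Fin N → ℝ) // MeasurableSet T}, testRisk n N A T.1

/-- The critical signal strength A*(δ, α; n). -/
def Astar (δ α : ℝ) (n : ℕ) : ℝ :=
  min ((n : ℝ) ^ (-(1 - α - δ))) (Real.sqrt (4 * (1 + δ) * α * Real.log n / n))

/-- Product of measures with densities. -/
lemma pi_withDensity_real {ι : Type*} [Fintype ι] {E : ι → Type*} [∀ i, MeasurableSpace (E i)]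
    (ν μ : ∀ i, Measure (E i)) [∀ i, IsProbabilityMeasure (ν i)] [∀ i, IsProbabilityMeasure (μ i)]
    (f : ∀ i, E i → ℝ) (hf : ∀ i x, 0 ≤ f i x) (hm : ∀ i, Measurable (f i))
    (h : ∀ i, μ i = (ν i).withDensity (fun x => ENNReal.ofReal (f i x))) :
    Measure.pi μ = (Measure.pi ν).withDensity (fun x => ENNReal.ofReal (∏ i, f i (x i))) := by
  have hint : ∀ i, Integrable (f i) (ν i) := by
    intro i
    refine ⟨(hm i).aestronglyMeasurable, ?_⟩
    rw [hasFiniteIntegral_iff_ofReal (Filter.Eventually.of_forall (hf i))]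
    have : μ i Set.univ = 1 := measure_univ
    rw [h i, withDensity_apply _ MeasurableSet.univ, Measure.restrict_univ] at this
    rw [this]; exact ENNReal.one_lt_top
  have hset : ∀ i (s : Set (E i)), MeasurableSet s →
      μ i s = ENNReal.ofReal (∫ x in s, f i x ∂(ν i)) := by
    intro i s hs
    rw [h i, withDensity_apply _ hs, ofReal_integral_eq_lintegral_ofReal (hint i).integrableOn
      (Filter.Eventually.of_forall (hf i))]
  refine Measure.pi_eq ?_
  intro s hs
  rw [withDensity_apply _ (MeasurableSet.univ_pi hs), Measure.restrict_pi_pi]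
  rw [← ofReal_integral_eq_lintegral_ofReal]
  · rw [integral_fintype_prod_eq_prod, ENNReal.ofReal_prod_of_nonneg]
    · exact Finset.prod_congr rfl fun i _ => (hset i _ (hs i)).symm
    · intro i _
      exact integral_nonneg (hf i)
  · exact Integrable.fintype_prod_dep fun i => (hint i).integrableOn
  · exact Filter.Eventually.of_forall fun x => Finset.prod_nonneg fun i _ => hf i _

/-- Inner product of matrices. -/
def ip {N : ℕ} (a b : Fin N → Fin N → ℝ) : ℝ := ∑ i, ∑ j, a i j * b i j

instance instProbPTheta (N : ℕ) (θ : Fin N → Fin N → ℝ) : IsProbabilityMeasure (PTheta N θ) := by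
  unfold PTheta; infer_instance

lemma gauss_withDensity (t : ℝ) : gaussianReal t 1 =
    (gaussianReal 0 1).withDensity (fun x => ENNReal.ofReal (Real.exp (t * x - t * t / 2))) := by
  rw [gaussianReal_of_var_ne_zero _ one_ne_zero, gaussianReal_of_var_ne_zero _ one_ne_zero,
    ← withDensity_mul _ (measurable_gaussianPDF _ _) (by fun_prop)]
  congr 1
  ext x
  simp only [gaussianPDF, Pi.mul_apply, gaussianPDFReal]
  rw [← ENNReal.ofReal_mul (by positivity), mul_assoc _ (Real.exp _) (Real.exp _), ← Real.exp_add]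
  congr 3
  simp
  ring

lemma measurable_ip {N : ℕ} (a : Fin N → Fin N → ℝ) : Measurable (fun X => ip a X) := by
  unfold ip; fun_prop

lemma PTheta_withDensity (N : ℕ) (θ : Fin N → Fin N → ℝ) :
    PTheta N θ = (PTheta N 0).withDensity
      (fun X => ENNReal.ofReal (Real.exp (ip θ X - ip θ θ / 2))) := by
  unfold PTheta
  rw [pi_withDensity_real (fun i => Measure.pi fun j => gaussianReal 0 1)
    (fun i => Measure.pi fun j => gaussianReal (θ i j) 1)
    (fun i x => ∏ j, Real.exp (θ i j * x j - θ i j * θ i j / 2))]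
  · congr 1
    ext X
    congr 1
    simp_rw [← Real.exp_sum]
    congr 1
    simp only [ip, Finset.sum_sub_distrib, Finset.sum_div]
  · intros; positivity
  · intro i; fun_prop
  · intro i
    exact pi_withDensity_real (fun j => gaussianReal 0 1)
      (fun j => gaussianReal (θ i j) 1) (fun j x => Real.exp (θ i j * x - θ i j * θ i j / 2))
      (by intros; positivity) (by intro j; fun_prop) (fun j => gauss_withDensity _)

lemma integrable_exp_ip {N : ℕ} (a : Fin N → Fin N → ℝ) (c : ℝ) :
    Integrable (fun X => Real.exp (ip a X + c)) (PTheta N 0) ∧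
    ∫ X, Real.exp (ip a X + c) ∂(PTheta N 0) = Real.exp (ip a a / 2 + c) := by
  have hm : Measurable (fun X => Real.exp (ip a X - ip a a / 2)) :=
    ((measurable_ip a).sub_const _).exp
  have h1 : ∫⁻ X, ENNReal.ofReal (Real.exp (ip a X - ip a a / 2)) ∂(PTheta N 0) = 1 := by
    have : PTheta N a Set.univ = 1 := measure_univ
    rwa [PTheta_withDensity, withDensity_apply _ MeasurableSet.univ, Measure.restrict_univ] at this
  have hi : Integrable (fun X => Real.exp (ip a X - ip a a / 2)) (PTheta N 0) := by
    refine ⟨hm.aestronglyMeasurable, ?_⟩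
    rw [hasFiniteIntegral_iff_ofReal (Filter.Eventually.of_forall fun _ => (Real.exp_pos _).le), h1]
    exact ENNReal.one_lt_top
  have hI : ∫ X, Real.exp (ip a X - ip a a / 2) ∂(PTheta N 0) = 1 := by
    rw [integral_eq_lintegral_of_nonneg_ae (Filter.Eventually.of_forall fun _ => (Real.exp_pos _).le)
      hm.aestronglyMeasurable, h1]; simp
  have he : (fun X => Real.exp (ip a X + c)) =
      fun X => Real.exp (ip a a / 2 + c) * Real.exp (ip a X - ip a a / 2) := by
    ext X; rw [← Real.exp_add]; congr 1; ring
  rw [he]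
  refine ⟨hi.const_mul _, ?_⟩
  rw [integral_const_mul, hI, mul_one]

lemma PTheta_apply {N : ℕ} (θ : Fin N → Fin N → ℝ) {T : Set (Fin N → Fin N → ℝ)}
    (hT : MeasurableSet T) : (PTheta N θ T).toReal =
      ∫ X in T, Real.exp (ip θ X - ip θ θ / 2) ∂(PTheta N 0) := by
  have hi := (integrable_exp_ip θ (-(ip θ θ / 2))).1
  simp only [← sub_eq_add_neg] at hi
  rw [PTheta_withDensity, withDensity_apply _ hT, ← ofReal_integral_eq_lintegral_ofReal
    hi.integrableOn (Filter.Eventually.of_forall fun _ => (Real.exp_pos _).le),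
    ENNReal.toReal_ofReal (integral_nonneg fun _ => (Real.exp_pos _).le)]

lemma ip_comm {N : ℕ} (a b : Fin N → Fin N → ℝ) : ip a b = ip b a := by
  unfold ip; simp only [mul_comm]

lemma ip_add_left {N : ℕ} (a b c : Fin N → Fin N → ℝ) : ip (a + b) c = ip a c + ip b c := by
  unfold ip; simp only [Pi.add_apply, add_mul, Finset.sum_add_distrib]

lemma ip_smul_left {N : ℕ} (t : ℝ) (a c : Fin N → Fin N → ℝ) : ip (t • a) c = t * ip a c := by
  unfold ip; simp only [Pi.smul_apply, smul_eq_mul, Finset.mul_sum, mul_assoc]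

lemma ip_add_right {N : ℕ} (a b c : Fin N → Fin N → ℝ) : ip c (a + b) = ip c a + ip c b := by
  rw [ip_comm, ip_add_left, ip_comm a, ip_comm b]

lemma ip_smul_right {N : ℕ} (t : ℝ) (a c : Fin N → Fin N → ℝ) : ip c (t • a) = t * ip c a := by
  rw [ip_comm, ip_smul_left, ip_comm a]

lemma ip_neg_left {N : ℕ} (a c : Fin N → Fin N → ℝ) : ip (-a) c = - ip a c := by
  unfold ip; simp

lemma ip_neg_right {N : ℕ} (a c : Fin N → Fin N → ℝ) : ip c (-a) = - ip c a := by
  unfold ip; simp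

lemma ip_sub_left {N : ℕ} (a b c : Fin N → Fin N → ℝ) : ip (a - b) c = ip a c - ip b c := by
  rw [sub_eq_add_neg, ip_add_left, ip_neg_left, sub_eq_add_neg]

lemma ip_sub_right {N : ℕ} (a b c : Fin N → Fin N → ℝ) : ip c (a - b) = ip c a - ip c b := by
  rw [sub_eq_add_neg, ip_add_right, ip_neg_right, sub_eq_add_neg]

lemma chernoff {N : ℕ} (θ b : Fin N → Fin N → ℝ) (c : ℝ) {T : Set (Fin N → Fin N → ℝ)}
    (hT : MeasurableSet T) (h : ∀ X ∈ T, 0 ≤ ip b X + c) :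
    (PTheta N θ T).toReal ≤ Real.exp (ip b θ + ip b b / 2 + c) := by
  have hi := integrable_exp_ip (θ + b) (c - ip θ θ / 2)
  have hj := (integrable_exp_ip θ (-(ip θ θ / 2))).1
  simp only [← sub_eq_add_neg] at hj
  rw [PTheta_apply θ hT]
  calc ∫ X in T, Real.exp (ip θ X - ip θ θ / 2) ∂(PTheta N 0)
      ≤ ∫ X in T, Real.exp (ip (θ + b) X + (c - ip θ θ / 2)) ∂(PTheta N 0) := by
        refine setIntegral_mono_on hj.integrableOn hi.1.integrableOn hT ?_
        intro X hX
        have := h X hX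
        rw [Real.exp_le_exp, ip_add_left]
        linarith
    _ ≤ ∫ X, Real.exp (ip (θ + b) X + (c - ip θ θ / 2)) ∂(PTheta N 0) :=
        setIntegral_le_integral hi.1 (Filter.Eventually.of_forall fun _ => (Real.exp_pos _).le)
    _ = Real.exp (ip b θ + ip b b / 2 + c) := by
        rw [hi.2]
        congr 1
        simp only [ip_add_left, ip_add_right, ip_comm θ b]
        ring

lemma testRisk_nonneg (n N : ℕ) (A : ℝ) (T : Set (Fin N → Fin N → ℝ)) :
    0 ≤ testRisk n N A T := by
  unfold testRisk
  exact add_nonneg ENNReal.toReal_nonneg (Real.iSup_nonneg fun _ => ENNReal.toReal_nonneg)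

lemma minimaxRisk_le (n N : ℕ) (A m : ℝ) (hN : 0 < N)
    (hm : 0 ≤ m) (hmA : m * N ≤ A * n ^ 2) :
    minimaxRisk n N A ≤ 2 * Real.exp (-(m ^ 2) / 8) := by
  have hN' : (0 : ℝ) < N := by exact_mod_cast hN
  set one : Fin N → Fin N → ℝ := fun _ _ => 1 with hone
  have h11 : ip one one = (N : ℝ) ^ 2 := by simp [ip, hone, sq]
  set l : ℝ := m / (2 * N) with hl
  set τ : ℝ := N * m / 2 with hτ
  have hl0 : 0 ≤ l := by positivity
  set T : Set (Fin N → Fin N → ℝ) := {X | τ ≤ ip one X} with hTdef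
  have hT : MeasurableSet T := measurableSet_le measurable_const (measurable_ip one)
  have hb : BddBelow (Set.range fun T : {T : Set (Fin N → Fin N → ℝ) // MeasurableSet T} =>
      testRisk n N A T.1) := ⟨0, by rintro _ ⟨T, rfl⟩; exact testRisk_nonneg _ _ _ _⟩
  refine (ciInf_le hb ⟨T, hT⟩).trans ?_
  have e1 : (PTheta N 0 T).toReal ≤ Real.exp (-(m ^ 2) / 8) := by
    refine (chernoff 0 (l • one) (-(l * τ)) hT ?_).trans ?_
    · intro X hX
      have : τ ≤ ip one X := hX
      rw [ip_smul_left]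
      nlinarith
    · rw [Real.exp_le_exp]
      have : ip (l • one) (0 : Fin N → Fin N → ℝ) = 0 := by simp [ip]
      rw [this, ip_smul_left, ip_smul_right, h11, hl, hτ]
      apply le_of_eq
      field_simp
      ring
  have e2 : ∀ θ : ThetaSet A n N, (PTheta N θ.1 Tᶜ).toReal ≤ Real.exp (-(m ^ 2) / 8) := by
    rintro ⟨θ, R, C, hR, hC, h1, h2⟩
    have hsum : A * n ^ 2 ≤ ip one θ := by
      have : ip one θ = ∑ i, ∑ j, θ i j := by simp [ip, hone]
      rw [this]
      calc A * n ^ 2 = ∑ i ∈ R, ∑ j ∈ C, A := by simp [hR, hC]; ring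
        _ ≤ ∑ i ∈ R, ∑ j ∈ C, θ i j :=
          Finset.sum_le_sum fun i hi => Finset.sum_le_sum fun j hj => h1 i j hi hj
        _ = ∑ i ∈ R, ∑ j, θ i j := by
          refine Finset.sum_congr rfl fun i hi => Finset.sum_subset (Finset.subset_univ _) ?_
          intro j _ hj
          exact h2 i j (fun h => hj h.2)
        _ = ∑ i, ∑ j, θ i j := by
          refine Finset.sum_subset (Finset.subset_univ _) ?_
          intro i _ hi
          exact Finset.sum_eq_zero fun j _ => h2 i j (fun h => hi h.1)
    refine (chernoff θ (-(l • one)) (l * τ) hT.compl ?_).trans ?_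
    · intro X hX
      have : ip one X < τ := lt_of_not_ge hX
      rw [ip_neg_left, ip_smul_left]
      nlinarith
    · rw [Real.exp_le_exp]
      have h3 : l * (m * N) ≤ l * ip one θ := by gcongr; linarith
      have h4 : l * (m * N) = m ^ 2 / 2 := by rw [hl]; field_simp
      have h5 : l * τ = m ^ 2 / 4 := by rw [hl, hτ]; field_simp; ring
      have h6 : l * (l * (N : ℝ) ^ 2) = m ^ 2 / 4 := by rw [hl]; field_simp; ring
      rw [ip_neg_left, ip_neg_left, ip_neg_right, ip_smul_left, ip_smul_left, ip_smul_right, h11]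
      linarith
  have e3 : ⨆ θ : ThetaSet A n N, (PTheta N θ.1 Tᶜ).toReal ≤ Real.exp (-(m ^ 2) / 8) :=
    Real.iSup_le e2 (Real.exp_pos _).le
  simp only [testRisk]
  linarith

lemma le_minimaxRisk (n N : ℕ) (A c : ℝ) {ι : Type*} [Fintype ι] [Nonempty ι]
    (θ : ι → Fin N → Fin N → ℝ) (hθ : ∀ k, θ k ∈ ThetaSet A n N)
    (h : c ≤ ∫ X, min 1 ((Fintype.card ι : ℝ)⁻¹ * ∑ k, Real.exp (ip (θ k) X - ip (θ k) (θ k) / 2))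
      ∂(PTheta N 0)) : c ≤ minimaxRisk n N A := by
  have : Nonempty {T : Set (Fin N → Fin N → ℝ) // MeasurableSet T} := ⟨⟨∅, MeasurableSet.empty⟩⟩
  refine le_ciInf ?_
  rintro ⟨T, hT⟩
  refine h.trans ?_
  have hcard : (0 : ℝ) < Fintype.card ι := by exact_mod_cast Fintype.card_pos
  have hk : ∀ k, (PTheta N (θ k) Tᶜ).toReal ≤ ⨆ θ : ThetaSet A n N, (PTheta N θ.1 Tᶜ).toReal := by
    intro k
    refine le_ciSup (f := fun θ : ThetaSet A n N => (PTheta N θ.1 Tᶜ).toReal) ?_ ⟨θ k, hθ k⟩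
    refine ⟨1, ?_⟩
    rintro _ ⟨t, rfl⟩
    exact measureReal_le_one
  have hint : ∀ k, Integrable (fun X => Real.exp (ip (θ k) X - ip (θ k) (θ k) / 2))
      (PTheta N 0) := fun k => (integrable_exp_ip (θ k) (-(ip (θ k) (θ k) / 2))).1
  have hL : Integrable (fun X => (Fintype.card ι : ℝ)⁻¹ *
      ∑ k, Real.exp (ip (θ k) X - ip (θ k) (θ k) / 2)) (PTheta N 0) :=
    (integrable_finsetSum _ fun k _ => hint k).const_mul _
  have hmin := (integrable_const (μ := PTheta N 0) (1 : ℝ)).inf hL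
  have h1 : ∫ X in T, min 1 ((Fintype.card ι : ℝ)⁻¹ *
      ∑ k, Real.exp (ip (θ k) X - ip (θ k) (θ k) / 2)) ∂(PTheta N 0) ≤ (PTheta N 0 T).toReal := by
    calc _ ≤ ∫ X in T, (1 : ℝ) ∂(PTheta N 0) :=
          setIntegral_mono hmin.integrableOn (integrable_const _) (fun X => min_le_left _ _)
      _ = _ := by simp [measureReal_def]
  have h2 : ∫ X in Tᶜ, min 1 ((Fintype.card ι : ℝ)⁻¹ *
      ∑ k, Real.exp (ip (θ k) X - ip (θ k) (θ k) / 2)) ∂(PTheta N 0)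
      ≤ ⨆ θ : ThetaSet A n N, (PTheta N θ.1 Tᶜ).toReal := by
    calc _ ≤ ∫ X in Tᶜ, (Fintype.card ι : ℝ)⁻¹ *
          ∑ k, Real.exp (ip (θ k) X - ip (θ k) (θ k) / 2) ∂(PTheta N 0) :=
          setIntegral_mono hmin.integrableOn hL.integrableOn (fun X => min_le_right _ _)
      _ = (Fintype.card ι : ℝ)⁻¹ * ∑ k, (PTheta N (θ k) Tᶜ).toReal := by
          rw [integral_const_mul, integral_finsetSum _ fun k _ => (hint k).integrableOn]
          simp only [PTheta_apply _ hT.compl]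
      _ ≤ (Fintype.card ι : ℝ)⁻¹ * ∑ k : ι, ⨆ θ : ThetaSet A n N, (PTheta N θ.1 Tᶜ).toReal := by
          gcongr with k; exact hk k
      _ = _ := by
          rw [Finset.sum_const, Finset.card_univ, nsmul_eq_mul, ← mul_assoc,
            inv_mul_cancel₀ hcard.ne', one_mul]
  have h3 := integral_add_compl hT hmin
  simp only [testRisk]
  change _ + _ = ∫ X, min 1 ((Fintype.card ι : ℝ)⁻¹ *
      ∑ k, Real.exp (ip (θ k) X - ip (θ k) (θ k) / 2)) ∂(PTheta N 0) at h3
  rw [← h3]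
  exact add_le_add h1 h2

lemma aux_min {k y : ℝ} (hk : 1 ≤ k) (hy : 0 ≤ y) :
    y ≤ k * min 1 y + (y + y ^ 2) / (4 * k) := by
  have hk0 : 0 < k := by linarith
  rcases le_total y 1 with h | h
  · rw [min_eq_right h]
    have : 0 ≤ (y + y ^ 2) / (4 * k) := by positivity
    nlinarith
  · rw [min_eq_left h]
    have h1 : y ^ 2 / (4 * k) ≤ (y + y ^ 2) / (4 * k) := by gcongr; linarith
    have h2 : k * 1 + y ^ 2 / (4 * k) - y = (2 * k - y) ^ 2 / (4 * k) := by field_simp; ring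
    have h3 : 0 ≤ (2 * k - y) ^ 2 / (4 * k) := by positivity
    linarith

lemma aux_pointwise {k y S m : ℝ} (hk : 1 ≤ k) (hy : 0 ≤ y) (hm : 0 ≤ m) :
    Real.exp (m / 2 * S - m ^ 2 / 8) * y ≤
      k * Real.exp (m ^ 2 / 8 + m) * min 1 (Real.exp (m * S - m ^ 2 / 2) * y)
      + (Real.exp (m / 2 * S - m ^ 2 / 8) * y + Real.exp (m / 2 * S - m ^ 2 / 8) * y ^ 2) / (4 * k)
      + Real.exp (-2) * (Real.exp (m / 2 * S - m ^ 2 / 8) * y * Real.exp (S - m / 2)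
        + Real.exp (m / 2 * S - m ^ 2 / 8) * y * Real.exp (-(S - m / 2))) := by
  have hk0 : 0 < k := by linarith
  set g := Real.exp (m / 2 * S - m ^ 2 / 8) with hg
  have hg0 : 0 < g := Real.exp_pos _
  have hmin0 : 0 ≤ min 1 (Real.exp (m * S - m ^ 2 / 2) * y) := by positivity
  have hA : 0 ≤ k * Real.exp (m ^ 2 / 8 + m) * min 1 (Real.exp (m * S - m ^ 2 / 2) * y) := by
    positivity
  have hB : 0 ≤ (g * y + g * y ^ 2) / (4 * k) := by positivity
  have hgy : 0 ≤ g * y := by positivity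
  have hC1 : 0 ≤ Real.exp (-2) * (g * y * Real.exp (S - m / 2)) := by positivity
  have hC2 : 0 ≤ Real.exp (-2) * (g * y * Real.exp (-(S - m / 2))) := by positivity
  rw [mul_add (Real.exp (-2))]
  by_cases h1 : 2 ≤ S - m / 2
  · have : g * y * 1 ≤ Real.exp (-2) * (g * y * Real.exp (S - m / 2)) := by
      rw [mul_left_comm, ← Real.exp_add]
      gcongr
      rw [← Real.exp_zero, Real.exp_le_exp]; linarith
    linarith
  by_cases h2 : S - m / 2 ≤ -2
  · have : g * y * 1 ≤ Real.exp (-2) * (g * y * Real.exp (-(S - m / 2))) := by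
      rw [mul_left_comm, ← Real.exp_add]
      gcongr
      rw [← Real.exp_zero, Real.exp_le_exp]; linarith
    linarith
  push Not at h1 h2
  have hmain : g * min 1 y ≤ Real.exp (m ^ 2 / 8 + m) *
      min 1 (Real.exp (m * S - m ^ 2 / 2) * y) := by
    rw [mul_min_of_nonneg _ _ (Real.exp_pos (m ^ 2 / 8 + m)).le]
    apply le_min
    · have : g ≤ Real.exp (m ^ 2 / 8 + m) := by
        rw [hg, Real.exp_le_exp]; nlinarith
      calc g * min 1 y ≤ g * 1 := by gcongr; exact min_le_left _ _
        _ ≤ _ := by linarith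
    · have : g ≤ Real.exp (m ^ 2 / 8 + m) * Real.exp (m * S - m ^ 2 / 2) := by
        rw [hg, ← Real.exp_add, Real.exp_le_exp]; nlinarith
      calc g * min 1 y ≤ g * y := by gcongr; exact min_le_right _ _
        _ ≤ (Real.exp (m ^ 2 / 8 + m) * Real.exp (m * S - m ^ 2 / 2)) * y := by gcongr
        _ = _ := by ring
  have h3 := mul_le_mul_of_nonneg_left (aux_min hk hy) hg0.le
  have h4 : g * (k * min 1 y + (y + y ^ 2) / (4 * k)) =
      k * (g * min 1 y) + (g * y + g * y ^ 2) / (4 * k) := by field_simp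
  have h5 := mul_le_mul_of_nonneg_left hmain hk0.le
  rw [h4] at h3
  rw [← mul_assoc] at h5
  linarith

lemma min_lower {N : ℕ} {ι : Type*} [Fintype ι] [Nonempty ι]
    (θ : ι → Fin N → Fin N → ℝ) (u : Fin N → Fin N → ℝ) (m K : ℝ) (hm : 0 ≤ m)
    (hu : ip u u = 1) (hθ : ∀ k, ip u (θ k) = m)
    (hK : (Fintype.card ι : ℝ)⁻¹ * ∑ k, ((Fintype.card ι : ℝ)⁻¹ *
      ∑ l, Real.exp (ip (θ k) (θ l) - m ^ 2)) ≤ K) :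
    Real.exp (-(m ^ 2 / 8) - m) / (4 * (1 + K)) ≤
      ∫ X, min 1 ((Fintype.card ι : ℝ)⁻¹ * ∑ k, Real.exp (ip (θ k) X - ip (θ k) (θ k) / 2))
      ∂(PTheta N 0) := by
  have hcard : (0 : ℝ) < Fintype.card ι := by exact_mod_cast Fintype.card_pos
  set c : ℝ := (Fintype.card ι : ℝ)⁻¹ with hc
  have hc0 : 0 < c := by positivity
  have hcsum : ∀ x : ℝ, c * ∑ _k : ι, x = x := by
    intro x
    rw [Finset.sum_const, Finset.card_univ, nsmul_eq_mul, ← mul_assoc, hc,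
      inv_mul_cancel₀ hcard.ne', one_mul]
  have hK0 : 0 ≤ K := le_trans (by positivity) hK
  set w : ι → Fin N → Fin N → ℝ := fun k => θ k - m • u with hw
  have huw : ∀ k, ip u (w k) = 0 := by
    intro k; simp only [hw, ip_sub_right, ip_smul_right, hu, hθ]; ring
  have hwu : ∀ k, ip (w k) u = 0 := fun k => by rw [ip_comm, huw]
  have hww : ∀ k l, ip (w k) (w l) = ip (θ k) (θ l) - m ^ 2 := by
    intro k l
    simp only [hw, ip_sub_right, ip_smul_right, ip_sub_left, ip_smul_left, hu, hθ, ip_comm _ u]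
    ring
  set L : (Fin N → Fin N → ℝ) → ℝ :=
    fun X => c * ∑ k, Real.exp (ip (θ k) X - ip (θ k) (θ k) / 2) with hL
  set y : (Fin N → Fin N → ℝ) → ℝ :=
    fun X => c * ∑ k, Real.exp (ip (w k) X - ip (w k) (w k) / 2) with hy
  have hLy : ∀ X, L X = Real.exp (m * ip u X - m ^ 2 / 2) * y X := by
    intro X
    simp only [hL, hy]
    rw [mul_left_comm]
    congr 1
    rw [Finset.mul_sum]
    refine Finset.sum_congr rfl fun k _ => ?_
    rw [← Real.exp_add, hww]
    congr 1
    simp only [hw, ip_sub_left, ip_smul_left]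
    ring
  have hy0 : ∀ X, 0 ≤ y X := fun X => by positivity
  set G : ℝ → (Fin N → Fin N → ℝ) → ℝ := fun s X => c * ∑ k, Real.exp
    (ip ((m / 2 + s) • u + w k) X + (-(m ^ 2 / 8) - ip (w k) (w k) / 2 - s * m / 2)) with hG
  set H : (Fin N → Fin N → ℝ) → ℝ := fun X => c * ∑ k, (c * ∑ l, Real.exp
    (ip ((m / 2) • u + w k + w l) X
      + (-(m ^ 2 / 8) - ip (w k) (w k) / 2 - ip (w l) (w l) / 2))) with hH
  have hGy : ∀ s X, G s X =
      Real.exp (m / 2 * ip u X - m ^ 2 / 8) * y X * Real.exp (s * (ip u X - m / 2)) := by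
    intro s X
    simp only [hG, hy]
    rw [mul_left_comm, mul_assoc]
    congr 1
    rw [Finset.mul_sum, Finset.sum_mul]
    refine Finset.sum_congr rfl fun k _ => ?_
    rw [← Real.exp_add, ← Real.exp_add]
    congr 1
    simp only [ip_add_left, ip_smul_left]
    ring
  have hHy : ∀ X, H X = Real.exp (m / 2 * ip u X - m ^ 2 / 8) * y X ^ 2 := by
    intro X
    simp only [hH, hy]
    rw [sq (c * _), mul_assoc c, mul_left_comm]
    congr 1
    rw [Finset.sum_mul, Finset.mul_sum]
    refine Finset.sum_congr rfl fun k _ => ?_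
    rw [mul_left_comm _ c, mul_left_comm _ c]
    congr 1
    rw [Finset.mul_sum, Finset.mul_sum]
    refine Finset.sum_congr rfl fun l _ => ?_
    rw [← Real.exp_add, ← Real.exp_add]
    congr 1
    simp only [ip_add_left, ip_smul_left]
    ring
  have hGi : ∀ s, Integrable (G s) (PTheta N 0) := fun s =>
    (integrable_finsetSum _ fun k _ => (integrable_exp_ip _ _).1).const_mul _
  have hGI : ∀ s, ∫ X, G s X ∂(PTheta N 0) = Real.exp (s ^ 2 / 2) := by
    intro s
    simp only [hG]
    rw [integral_const_mul, integral_finsetSum _ fun k _ => (integrable_exp_ip _ _).1]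
    rw [← hcsum (Real.exp (s ^ 2 / 2))]
    congr 1
    refine Finset.sum_congr rfl fun k _ => ?_
    rw [(integrable_exp_ip _ _).2]
    congr 1
    simp only [ip_add_left, ip_smul_left, ip_add_right, ip_smul_right, hu, huw, hwu]
    ring
  have hHi : Integrable H (PTheta N 0) :=
    (integrable_finsetSum _ fun k _ =>
      (integrable_finsetSum _ fun l _ => (integrable_exp_ip _ _).1).const_mul _).const_mul _
  have hHI : ∫ X, H X ∂(PTheta N 0) ≤ K := by
    refine le_trans (le_of_eq ?_) hK
    simp only [hH]
    rw [integral_const_mul, integral_finsetSum _ fun k _ =>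
      (integrable_finsetSum _ fun l _ => (integrable_exp_ip _ _).1).const_mul _]
    congr 1
    refine Finset.sum_congr rfl fun k _ => ?_
    rw [integral_const_mul, integral_finsetSum _ fun l _ => (integrable_exp_ip _ _).1]
    congr 1
    refine Finset.sum_congr rfl fun l _ => ?_
    rw [(integrable_exp_ip _ _).2, ← hww]
    congr 1
    simp only [ip_add_left, ip_smul_left, ip_add_right, ip_smul_right, hu, huw, hwu,
      ip_comm (w l) (w k)]
    ring
  have hLi : Integrable L (PTheta N 0) :=
    (integrable_finsetSum _ fun k _ =>
      (integrable_exp_ip (θ k) (-(ip (θ k) (θ k) / 2))).1).const_mul _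
  have hmin : Integrable (fun X => min 1 (L X)) (PTheta N 0) :=
    (integrable_const (μ := PTheta N 0) (1 : ℝ)).inf hLi
  have hpt : ∀ X, G 0 X ≤ (1 + K) * Real.exp (m ^ 2 / 8 + m) * min 1 (L X)
      + (G 0 X + H X) / (4 * (1 + K)) + Real.exp (-2) * (G 1 X + G (-1) X) := by
    intro X
    have := aux_pointwise (k := 1 + K) (y := y X) (S := ip u X) (m := m) (by linarith) (hy0 X) hm
    rw [hGy, hGy, hGy, hHy, hLy]
    simpa using this
  have i1 := hmin.const_mul ((1 + K) * Real.exp (m ^ 2 / 8 + m))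
  have i2 := ((hGi 0).add hHi).div_const (4 * (1 + K))
  have i3 := ((hGi 1).add (hGi (-1))).const_mul (Real.exp (-2))
  have hI := integral_mono (hGi 0) ((i1.add i2).add i3) hpt
  have e1 := integral_add (i1.add i2) i3
  have e2 := integral_add i1 i2
  simp only [Pi.add_apply] at hI e1 e2
  have e3 : ∫ X, Real.exp (-2) * (G 1 X + G (-1) X) ∂(PTheta N 0) =
      Real.exp (-2) * (Real.exp (1 ^ 2 / 2) + Real.exp ((-1) ^ 2 / 2)) := by
    rw [integral_const_mul (Real.exp (-2)), integral_add (hGi 1) (hGi (-1)), hGI, hGI]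
  have e4 : ∫ X, (G 0 X + H X) / (4 * (1 + K)) ∂(PTheta N 0) =
      (Real.exp (0 ^ 2 / 2) + ∫ X, H X ∂(PTheta N 0)) / (4 * (1 + K)) := by
    rw [integral_div, integral_add (hGi 0) hHi, hGI]
  have e5 := integral_const_mul (μ := PTheta N 0) ((1 + K) * Real.exp (m ^ 2 / 8 + m))
    (fun X => min 1 (L X))
  rw [e1, e2, e3, e4, e5, hGI] at hI
  set I := ∫ X, min 1 (L X) ∂(PTheta N 0) with hIdef
  have hq : (Real.exp (0 ^ 2 / 2) + ∫ X, H X ∂(PTheta N 0)) / (4 * (1 + K)) ≤ 1 / 4 := by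
    rw [div_le_iff₀ (by positivity)]
    norm_num
    linarith
  have hr : Real.exp (-2) * (Real.exp (1 ^ 2 / 2) + Real.exp ((-1) ^ 2 / 2)) ≤ 1 / 2 := by
    have h1 : Real.exp (-2) * (Real.exp (1 ^ 2 / 2) + Real.exp ((-1) ^ 2 / 2))
        = 2 * Real.exp (-(3 / 2)) := by
      rw [mul_add, ← Real.exp_add, ← Real.exp_add]; norm_num; ring
    rw [h1, Real.exp_neg]
    have h2 : (4 : ℝ) ≤ Real.exp (3 / 2) := by
      have h3 := Real.exp_one_gt_d9
      have h4 := Real.add_one_le_exp (1 / 2 : ℝ)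
      have h5 : Real.exp (3 / 2) = Real.exp 1 * Real.exp (1 / 2) := by
        rw [← Real.exp_add]; norm_num
      rw [h5]; nlinarith
    have h6 : (Real.exp (3 / 2))⁻¹ ≤ (4 : ℝ)⁻¹ := inv_anti₀ (by norm_num) h2
    linarith
  have hfin : (1 : ℝ) / 4 ≤ (1 + K) * Real.exp (m ^ 2 / 8 + m) * I := by
    have : Real.exp (0 ^ 2 / 2) = 1 := by norm_num
    linarith
  have hneg : Real.exp (-(m ^ 2 / 8) - m) = (Real.exp (m ^ 2 / 8 + m))⁻¹ := by
    rw [← Real.exp_neg]; congr 1; ring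
  rw [hneg, div_le_iff₀ (by positivity), inv_le_iff_one_le_mul₀ (Real.exp_pos _)]
  linarith

/-- number of agreements of two functions -/
def agr {n M : ℕ} (r r' : Fin n → Fin M) : ℝ := ∑ i, if r i = r' i then (1 : ℝ) else 0

lemma agr_nonneg {n M : ℕ} (r r' : Fin n → Fin M) : 0 ≤ agr r r' :=
  Finset.sum_nonneg fun i _ => by split_ifs <;> norm_num

lemma agr_le {n M : ℕ} (r r' : Fin n → Fin M) : agr r r' ≤ n := by
  calc agr r r' ≤ ∑ _i : Fin n, (1 : ℝ) :=
        Finset.sum_le_sum fun i _ => by split_ifs <;> norm_num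
    _ = n := by simp

lemma exp_agr_avg {n M : ℕ} (hM : 0 < M) (r : Fin n → Fin M) (s : ℝ) (hs : 0 ≤ s) :
    ((M : ℝ) ^ n)⁻¹ * ∑ r' : Fin n → Fin M, Real.exp (s * agr r r') ≤
      Real.exp ((n : ℝ) / M * (Real.exp s - 1)) := by
  have hM' : (0 : ℝ) < M := by exact_mod_cast hM
  have h1 : ∀ r' : Fin n → Fin M, Real.exp (s * agr r r') =
      ∏ i, (if r i = r' i then Real.exp s else 1) := by
    intro r'
    rw [agr, Finset.mul_sum, Real.exp_sum]
    refine Finset.prod_congr rfl fun i _ => ?_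
    split_ifs <;> simp
  have h2 : ∑ r' : Fin n → Fin M, ∏ i, (if r i = r' i then Real.exp s else 1) =
      ∏ i : Fin n, ∑ j : Fin M, (if r i = j then Real.exp s else 1) := by
    rw [Finset.prod_univ_sum, Fintype.piFinset_univ]
  have h3 : ∀ i : Fin n, ∑ j : Fin M, (if r i = j then Real.exp s else 1) =
      M * (1 + (Real.exp s - 1) / M) := by
    intro i
    have : ∀ j : Fin M, (if r i = j then Real.exp s else 1) =
        1 + (if r i = j then (Real.exp s - 1) else 0) := by
      intro j; split_ifs <;> ring
    simp only [this, Finset.sum_add_distrib, Finset.sum_ite_eq, Finset.mem_univ, if_true]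
    simp
    field_simp
  simp only [h1]
  rw [h2]
  simp only [h3, Finset.prod_const, Finset.card_univ, Fintype.card_fin]
  rw [mul_pow, ← mul_assoc, inv_mul_cancel₀ (by positivity), one_mul]
  have hp : 0 ≤ (Real.exp s - 1) / M := by
    have := Real.one_le_exp hs
    exact div_nonneg (by linarith) hM'.le
  calc (1 + (Real.exp s - 1) / M) ^ n ≤ (Real.exp ((Real.exp s - 1) / M)) ^ n := by
        gcongr
        rw [add_comm]; exact Real.add_one_le_exp _
    _ = _ := by rw [← Real.exp_nat_mul]; congr 1; ring

lemma exp_sub_one_le {x : ℝ} (h0 : 0 ≤ x) (h1 : x ≤ 1) : Real.exp x - 1 ≤ x + x ^ 2 := by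
  have := abs_le.1 (Real.abs_exp_sub_one_sub_id_le (x := x) (by rw [abs_of_nonneg h0]; exact h1))
  linarith [this.2]

lemma second_moment {n M : ℕ} (hM : 0 < M) (a l : ℝ) (ha : 0 ≤ a)
    (han : a * n ≤ 1) (hl : l = a * (n / M)) (hl1 : l ≤ 1 / 42) (r c : Fin n → Fin M) :
    ((M : ℝ) ^ n)⁻¹ * ∑ r' : Fin n → Fin M, (((M : ℝ) ^ n)⁻¹ *
      ∑ c' : Fin n → Fin M, Real.exp (a * (agr r r' * agr c c') - a * (n / M) ^ 2)) ≤
      2 * Real.exp (24 * l * (a * (n / M) ^ 2)) := by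
  have hM' : (0 : ℝ) < M := by exact_mod_cast hM
  set μ : ℝ := (n : ℝ) / M with hμ
  have hμ0 : 0 ≤ μ := by positivity
  have hl0 : 0 ≤ l := by rw [hl]; positivity
  set s₁ : ℝ := l * (1 + 21 * l) with hs₁
  set s₂ : ℝ := 2 * l + 1 with hs₂
  have hin : ∀ r' : Fin n → Fin M, ((M : ℝ) ^ n)⁻¹ *
      ∑ c' : Fin n → Fin M, Real.exp (a * (agr r r' * agr c c') - a * μ ^ 2) ≤
      Real.exp (-(a * μ ^ 2)) * (Real.exp (s₁ * agr r r') +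
        Real.exp (-(21 * μ)) * Real.exp (s₂ * agr r r')) := by
    intro r'
    set h := agr r r' with hh
    have hh0 : 0 ≤ h := agr_nonneg _ _
    have hx0 : 0 ≤ a * h := by positivity
    have hx1 : a * h ≤ 1 := le_trans (mul_le_mul_of_nonneg_left (agr_le _ _) ha) han
    have e1 : ∀ c' : Fin n → Fin M, Real.exp (a * (h * agr c c') - a * μ ^ 2) =
        Real.exp (-(a * μ ^ 2)) * Real.exp ((a * h) * agr c c') := by
      intro c'; rw [← Real.exp_add]; congr 1; ring
    simp only [e1]
    rw [← Finset.mul_sum, mul_left_comm]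
    refine mul_le_mul_of_nonneg_left ?_ (Real.exp_pos _).le
    refine (exp_agr_avg hM c (a * h) hx0).trans ?_
    have hx2 := exp_sub_one_le hx0 hx1
    have hlh : μ * (a * h) = l * h := by rw [hl]; ring
    have hstep : μ * (Real.exp (a * h) - 1) ≤ l * h * (1 + a * h) := by
      calc μ * (Real.exp (a * h) - 1) ≤ μ * (a * h + (a * h) ^ 2) := by gcongr
        _ = l * h * (1 + a * h) := by rw [← hlh]; ring
    rcases le_total h (21 * μ) with hc | hc
    · have h1 : a * h ≤ 21 * l := by
        calc a * h ≤ a * (21 * μ) := by gcongr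
          _ = 21 * l := by rw [hl]; ring
      have h2 : μ * (Real.exp (a * h) - 1) ≤ s₁ * h := by
        refine hstep.trans ?_
        rw [hs₁]
        have : l * h * (1 + a * h) ≤ l * h * (1 + 21 * l) := by gcongr
        linarith
      have h3 := Real.exp_le_exp.2 h2
      have h4 : 0 ≤ Real.exp (-(21 * μ)) * Real.exp (s₂ * h) := by positivity
      linarith
    · have h2 : μ * (Real.exp (a * h) - 1) ≤ -(21 * μ) + s₂ * h := by
        refine hstep.trans ?_
        rw [hs₂]
        have : l * h * (1 + a * h) ≤ l * h * (1 + 1) := by gcongr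
        linarith
      have h3 := Real.exp_le_exp.2 h2
      rw [Real.exp_add] at h3
      have h4 : 0 ≤ Real.exp (s₁ * h) := by positivity
      linarith
  have hs10 : 0 ≤ s₁ := by positivity
  have hs20 : 0 ≤ s₂ := by positivity
  have hb1 := exp_agr_avg hM r s₁ hs10
  have hb2 := exp_agr_avg hM r s₂ hs20
  have hs1b : s₁ ≤ 2 * l := by rw [hs₁]; nlinarith
  have hf1 : μ * (Real.exp s₁ - 1) ≤ a * μ ^ 2 + 24 * l * (a * μ ^ 2) := by
    have h1 : Real.exp s₁ - 1 ≤ s₁ + s₁ ^ 2 := exp_sub_one_le hs10 (by linarith)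
    have h2 : s₁ + s₁ ^ 2 ≤ l * (1 + 24 * l) := by
      have h5 : s₁ + s₁ ^ 2 ≤ s₁ * (1 + 2 * l) := by nlinarith
      have h6 : (1 + 21 * l) * (1 + 2 * l) ≤ 1 + 24 * l := by nlinarith
      have h7 : s₁ * (1 + 2 * l) = l * ((1 + 21 * l) * (1 + 2 * l)) := by rw [hs₁]; ring
      rw [h7] at h5
      exact h5.trans (mul_le_mul_of_nonneg_left h6 hl0)
    calc μ * (Real.exp s₁ - 1) ≤ μ * (l * (1 + 24 * l)) := by
          apply mul_le_mul_of_nonneg_left _ hμ0; linarith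
      _ = _ := by rw [hl]; ring
  have hf2 : Real.exp s₂ ≤ 22 := by
    have h1 : Real.exp s₂ ≤ Real.exp 1 * Real.exp 1 := by
      rw [← Real.exp_add, Real.exp_le_exp]; linarith
    have h2 := Real.exp_one_lt_d9
    have h3 := Real.exp_pos 1
    nlinarith
  have hf2' : -(21 * μ) + μ * (Real.exp s₂ - 1) ≤ 0 := by nlinarith
  calc ((M : ℝ) ^ n)⁻¹ * ∑ r' : Fin n → Fin M, (((M : ℝ) ^ n)⁻¹ *
      ∑ c' : Fin n → Fin M, Real.exp (a * (agr r r' * agr c c') - a * μ ^ 2))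
      ≤ ((M : ℝ) ^ n)⁻¹ * ∑ r' : Fin n → Fin M, Real.exp (-(a * μ ^ 2)) * (Real.exp (s₁ * agr r r') +
        Real.exp (-(21 * μ)) * Real.exp (s₂ * agr r r')) := by
        exact mul_le_mul_of_nonneg_left (Finset.sum_le_sum fun r' _ => hin r') (by positivity)
    _ = Real.exp (-(a * μ ^ 2)) * (((M : ℝ) ^ n)⁻¹ * ∑ r' : Fin n → Fin M, Real.exp (s₁ * agr r r')
        + Real.exp (-(21 * μ)) * (((M : ℝ) ^ n)⁻¹ *
          ∑ r' : Fin n → Fin M, Real.exp (s₂ * agr r r'))) := by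
        rw [← Finset.mul_sum, Finset.sum_add_distrib, ← Finset.mul_sum]; ring
    _ ≤ Real.exp (-(a * μ ^ 2)) * (Real.exp (a * μ ^ 2 + 24 * l * (a * μ ^ 2)) + 1) := by
        gcongr
        · exact hb1.trans (Real.exp_le_exp.2 hf1)
        · calc _ ≤ Real.exp (-(21 * μ)) * Real.exp (μ * (Real.exp s₂ - 1)) := by gcongr
            _ ≤ 1 := by rw [← Real.exp_add]; exact Real.exp_le_one_iff.2 hf2'
    _ ≤ 2 * Real.exp (24 * l * (a * μ ^ 2)) := by
        rw [mul_add, ← Real.exp_add, mul_one]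
        have h1 : Real.exp (-(a * μ ^ 2)) ≤ Real.exp (24 * l * (a * μ ^ 2)) := by
          rw [Real.exp_le_exp]
          have : 0 ≤ a * μ ^ 2 := by positivity
          nlinarith [mul_nonneg hl0 this]
        have h2 : -(a * μ ^ 2) + (a * μ ^ 2 + 24 * l * (a * μ ^ 2)) = 24 * l * (a * μ ^ 2) := by ring
        rw [h2]; linarith

/-- The row set selected by `r`. -/
def selSet {n M N : ℕ} (e : Fin n × Fin M ↪ Fin N) (r : Fin n → Fin M) : Finset (Fin N) :=
  Finset.univ.map ⟨fun i => e (i, r i), fun i j h => by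
    have := e.injective h
    exact (Prod.mk.inj this).1⟩

lemma selSet_card {n M N : ℕ} (e : Fin n × Fin M ↪ Fin N) (r : Fin n → Fin M) :
    (selSet e r).card = n := by simp [selSet]

/-- indicator of selSet -/
def chi {n M N : ℕ} (e : Fin n × Fin M ↪ Fin N) (r : Fin n → Fin M) (x : Fin N) : ℝ :=
  if x ∈ selSet e r then 1 else 0

/-- indicator of range -/
def chiAll {n M N : ℕ} (e : Fin n × Fin M ↪ Fin N) (x : Fin N) : ℝ :=
  if x ∈ Finset.univ.map e then 1 else 0

lemma sum_chi {n M N : ℕ} (e : Fin n × Fin M ↪ Fin N) (r : Fin n → Fin M) (f : Fin N → ℝ) :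
    ∑ x, chi e r x * f x = ∑ i, f (e (i, r i)) := by
  simp only [chi, ite_mul, one_mul, zero_mul, Finset.sum_ite_mem, Finset.univ_inter]
  rw [selSet, Finset.sum_map]
  rfl

lemma mem_selSet {n M N : ℕ} (e : Fin n × Fin M ↪ Fin N) (r : Fin n → Fin M) (x : Fin N) :
    x ∈ selSet e r ↔ ∃ i, e (i, r i) = x := by
  rw [selSet, Finset.mem_map]
  constructor
  · rintro ⟨i, _, h⟩; exact ⟨i, h⟩
  · rintro ⟨i, h⟩; exact ⟨i, Finset.mem_univ _, h⟩

lemma sum_chi_chi {n M N : ℕ} (e : Fin n × Fin M ↪ Fin N) (r r' : Fin n → Fin M) :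
    ∑ x, chi e r x * chi e r' x = agr r r' := by
  rw [sum_chi, agr]
  refine Finset.sum_congr rfl fun i _ => ?_
  have h : e (i, r i) ∈ selSet e r' ↔ r i = r' i := by
    rw [mem_selSet]
    constructor
    · rintro ⟨j, h⟩
      have h2 := Prod.mk.inj (e.injective h)
      obtain ⟨rfl, h3⟩ := h2
      exact h3.symm
    · intro h; exact ⟨i, by rw [h]⟩
  simp only [chi, h]

lemma sum_chiAll_chi {n M N : ℕ} (e : Fin n × Fin M ↪ Fin N) (r : Fin n → Fin M) :
    ∑ x, chiAll e x * chi e r x = n := by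
  simp only [mul_comm (chiAll e _)]
  rw [sum_chi]
  simp [chiAll]

lemma sum_chiAll {n M N : ℕ} (e : Fin n × Fin M ↪ Fin N) :
    ∑ x, chiAll e x * chiAll e x = n * M := by
  simp only [chiAll, ite_mul, one_mul, zero_mul, Finset.sum_ite_mem, Finset.univ_inter]
  simp

lemma ip_tensor {N : ℕ} (s t : ℝ) (x y x' y' : Fin N → ℝ) :
    ip (fun i j => s * (x i * y j)) (fun i j => t * (x' i * y' j)) =
      s * t * ((∑ i, x i * x' i) * (∑ j, y j * y' j)) := by
  rw [ip, Finset.sum_mul_sum, Finset.mul_sum]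
  refine Finset.sum_congr rfl fun i _ => ?_
  rw [Finset.mul_sum]
  refine Finset.sum_congr rfl fun j _ => ?_
  ring

lemma le_risk (n M N : ℕ) (hn : 0 < n) (hM : 0 < M) (hMN : n * M ≤ N) (A l m : ℝ)
    (hA : 0 ≤ A) (hAn : A ^ 2 * n ≤ 1) (hl : l = A ^ 2 * (n / M)) (hl1 : l ≤ 1 / 42)
    (hm : m = A * (n / M)) :
    Real.exp (-(m ^ 2 / 8) - m) / (4 * (1 + 2 * Real.exp (24 * l * m ^ 2))) ≤
      minimaxRisk n N A := by
  have hM' : (0 : ℝ) < M := by exact_mod_cast hM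
  have hn' : (0 : ℝ) < n := by exact_mod_cast hn
  have : Nonempty (Fin M) := ⟨⟨0, hM⟩⟩
  have hm2 : m ^ 2 = A ^ 2 * (n / M) ^ 2 := by rw [hm]; ring
  let e : Fin n × Fin M ↪ Fin N :=
    finProdFinEquiv.toEmbedding.trans (Fin.castLEEmb hMN)
  let θ : (Fin n → Fin M) × (Fin n → Fin M) → Fin N → Fin N → ℝ :=
    fun k i j => A * (chi e k.1 i * chi e k.2 j)
  let u : Fin N → Fin N → ℝ := fun i j => ((n : ℝ) * M)⁻¹ * (chiAll e i * chiAll e j)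
  refine le_minimaxRisk n N A _ θ ?_ (min_lower θ u m _ (by rw [hm]; positivity) ?_ ?_ ?_)
  · rintro ⟨r, c⟩
    refine ⟨selSet e r, selSet e c, selSet_card _ _, selSet_card _ _, ?_, ?_⟩
    · intro i j hi hj
      simp [θ, chi, hi, hj]
    · intro i j h
      simp only [θ, chi]
      by_cases hi : i ∈ selSet e r
      · have hj : j ∉ selSet e c := fun hj => h ⟨hi, hj⟩
        simp [hj]
      · simp [hi]
  · simp only [u]
    rw [ip_tensor, sum_chiAll]
    field_simp
  · rintro ⟨r, c⟩
    simp only [u, θ]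
    rw [ip_tensor, sum_chiAll_chi, sum_chiAll_chi, hm]
    field_simp
  · have hcard : (Fintype.card ((Fin n → Fin M) × (Fin n → Fin M)) : ℝ) =
        (M : ℝ) ^ n * (M : ℝ) ^ n := by simp
    have hc0 : (0 : ℝ) < (M : ℝ) ^ n * (M : ℝ) ^ n := by positivity
    have hk : ∀ k, (Fintype.card ((Fin n → Fin M) × (Fin n → Fin M)) : ℝ)⁻¹ *
        ∑ l, Real.exp (ip (θ k) (θ l) - m ^ 2) ≤ 2 * Real.exp (24 * l * m ^ 2) := by
      rintro ⟨r, c⟩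
      have h1 := second_moment hM (A ^ 2) l (sq_nonneg A) hAn hl hl1 r c
      rw [← hm2] at h1
      refine le_trans (le_of_eq ?_) h1
      rw [hcard, mul_inv, mul_assoc, Fintype.sum_prod_type, Finset.mul_sum]
      congr 1
      refine Finset.sum_congr rfl fun r' _ => ?_
      congr 1
      refine Finset.sum_congr rfl fun c' _ => ?_
      simp only [θ]
      rw [ip_tensor, sum_chi_chi, sum_chi_chi, sq A]
    calc _ ≤ (Fintype.card ((Fin n → Fin M) × (Fin n → Fin M)) : ℝ)⁻¹ *
          ∑ _k : (Fin n → Fin M) × (Fin n → Fin M), 2 * Real.exp (24 * l * m ^ 2) := by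
          exact mul_le_mul_of_nonneg_left (Finset.sum_le_sum fun k _ => hk k) (by positivity)
      _ = _ := by
          rw [Finset.sum_const, Finset.card_univ, nsmul_eq_mul, ← mul_assoc, inv_mul_cancel₀, one_mul]
          rw [hcard]; positivity

lemma Astar_eq (α δ : ℝ) (hα : 0 < α) (hδ : 0 < δ) (hαδ : α + δ ≤ 1 / 2) :
    ∀ᶠ n : ℕ in atTop, Astar δ α n = (n : ℝ) ^ (-(1 - α - δ)) := by
  have hlog : Tendsto (fun n : ℕ => Real.log n) atTop atTop :=
    Real.tendsto_log_atTop.comp tendsto_natCast_atTop_atTop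
  have hc : 0 < 4 * (1 + δ) * α := by positivity
  filter_upwards [eventually_ge_atTop 1, hlog.eventually_ge_atTop (1 / (4 * (1 + δ) * α))]
    with n hn hl
  have hn1 : (1 : ℝ) ≤ n := by exact_mod_cast hn
  have hn0 : (0 : ℝ) < n := by linarith
  rw [Astar, min_eq_left]
  apply Real.le_sqrt_of_sq_le
  rw [div_le_iff₀ hc] at hl
  calc ((n : ℝ) ^ (-(1 - α - δ))) ^ 2 = (n : ℝ) ^ (-(1 - α - δ) * 2) := by
        rw [← Real.rpow_natCast, ← Real.rpow_mul hn0.le]; norm_num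
    _ ≤ (n : ℝ) ^ (-1 : ℝ) := Real.rpow_le_rpow_of_exponent_le hn1 (by linarith)
    _ = 1 / n := by rw [Real.rpow_neg_one, one_div]
    _ ≤ 4 * (1 + δ) * α * Real.log n / n := by gcongr; linarith

/-- **Dense above-boundary regime.**  For fixed α > 0, δ > 0 with α + δ ≤ 1/2, the minimax
risk at signal strength `A*(δ, α; n)` with `N = ⌊n^{1+α}⌋` satisfies
`log R_n(A*) / n^{2δ} → -1/8`. -/
theorem dense_above_boundary (α δ : ℝ) (hα : 0 < α) (hδ : 0 < δ) (hαδ : α + δ ≤ 1 / 2) :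
    Tendsto (fun n : ℕ =>
        Real.log (minimaxRisk n ⌊(n : ℝ) ^ (1 + α)⌋₊ (Astar δ α n)) / (n : ℝ) ^ (2 * δ))
      atTop (𝓝 (-1 / 8)) := by
  have hcast : Tendsto (fun n : ℕ => (n : ℝ)) atTop atTop := tendsto_natCast_atTop_atTop
  -- the basic sequences
  set t : ℕ → ℝ := fun n => (n : ℝ) ^ δ with ht
  set ρ : ℕ → ℝ := fun n => ((⌊(n : ℝ) ^ α⌋₊ : ℝ) / (n : ℝ) ^ α)⁻¹ with hρ
  set l : ℕ → ℝ := fun n => (n : ℝ) ^ (-(1 - α - 2 * δ)) * ρ n with hl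
  have htT : Tendsto t atTop atTop := (tendsto_rpow_atTop hδ).comp hcast
  have hpow : Tendsto (fun n : ℕ => (n : ℝ) ^ α) atTop atTop := (tendsto_rpow_atTop hα).comp hcast
  have hρT : Tendsto ρ atTop (𝓝 1) := by
    have := ((tendsto_nat_floor_div_atTop (R := ℝ)).comp hpow).inv₀ one_ne_zero
    rw [inv_one] at this
    exact this
  have hlT : Tendsto l atTop (𝓝 0) := by
    have h1 : Tendsto (fun n : ℕ => (n : ℝ) ^ (-(1 - α - 2 * δ))) atTop (𝓝 0) :=
      (tendsto_rpow_neg_atTop (by linarith)).comp hcast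
    have := h1.mul hρT
    rwa [zero_mul] at this
  have htinv : Tendsto (fun n => (t n)⁻¹) atTop (𝓝 0) := tendsto_inv_atTop_zero.comp htT
  -- bounds
  have hlowT : Tendsto (fun n => -(ρ n ^ 2 / 8) - ρ n * (t n)⁻¹ - Real.log 12 * (t n)⁻¹ ^ 2
      - 24 * l n * ρ n ^ 2) atTop (𝓝 (-1 / 8)) := by
    have := ((((hρT.pow 2).div_const 8).neg.sub (hρT.mul htinv)).sub
      ((htinv.pow 2).const_mul (Real.log 12))).sub ((hlT.const_mul 24).mul (hρT.pow 2))
    refine this.trans_eq ?_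
    norm_num
  have hupT : Tendsto (fun n => Real.log 2 * (t n)⁻¹ ^ 2 - 1 / 8) atTop (𝓝 (-1 / 8)) := by
    have := ((htinv.pow 2).const_mul (Real.log 2)).sub_const (1 / 8)
    refine this.trans_eq ?_
    norm_num
  have hmain : ∀ᶠ n : ℕ in atTop,
      Real.exp (-((t n * ρ n) ^ 2 / 8) - t n * ρ n) /
        (4 * (1 + 2 * Real.exp (24 * l n * (t n * ρ n) ^ 2))) ≤
        minimaxRisk n ⌊(n : ℝ) ^ (1 + α)⌋₊ (Astar δ α n) ∧
      minimaxRisk n ⌊(n : ℝ) ^ (1 + α)⌋₊ (Astar δ α n) ≤ 2 * Real.exp (-(t n ^ 2) / 8) ∧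
      0 < t n ∧ 0 ≤ l n := by
    filter_upwards [eventually_ge_atTop 1, Astar_eq α δ hα hδ hαδ, hpow.eventually_ge_atTop 1,
      hlT.eventually_le_const (show (0 : ℝ) < 1 / 42 by norm_num)] with n hn hA hp1 hl42
    have hn1 : (1 : ℝ) ≤ n := by exact_mod_cast hn
    have hn0 : (0 : ℝ) < n := by linarith
    have hM : 0 < ⌊(n : ℝ) ^ α⌋₊ := Nat.floor_pos.2 hp1
    have hM' : (0 : ℝ) < (⌊(n : ℝ) ^ α⌋₊ : ℝ) := by exact_mod_cast hM
    have hp0 : (0 : ℝ) < (n : ℝ) ^ α := by positivity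
    have ht0 : 0 < t n := by positivity
    have hρ0 : 0 < ρ n := by positivity
    have hA0 : 0 < (n : ℝ) ^ (-(1 - α - δ)) := by positivity
    rw [hA]
    have hsplit : (n : ℝ) / (⌊(n : ℝ) ^ α⌋₊ : ℝ) = (n : ℝ) ^ (1 - α) * ρ n := by
      rw [Real.rpow_sub hn0, Real.rpow_one]
      simp only [hρ]
      field_simp
    have hA2 : ((n : ℝ) ^ (-(1 - α - δ))) ^ 2 = (n : ℝ) ^ (-(1 - α - δ) * 2) := by
      rw [← Real.rpow_natCast, ← Real.rpow_mul hn0.le]; norm_num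
    refine ⟨?_, ?_, ht0, by positivity⟩
    · refine le_risk n ⌊(n : ℝ) ^ α⌋₊ _ hn hM ?_ _ (l n) (t n * ρ n) hA0.le ?_ ?_ hl42 ?_
      · apply Nat.le_floor
        push_cast
        rw [Real.rpow_add hn0, Real.rpow_one]
        gcongr
        exact Nat.floor_le hp0.le
      · rw [hA2]
        nth_rewrite 2 [← Real.rpow_one (n : ℝ)]
        rw [← Real.rpow_add hn0]
        exact Real.rpow_le_one_of_one_le_of_nonpos hn1 (by linarith)
      · rw [hsplit, hA2, ← mul_assoc, ← Real.rpow_add hn0]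
        simp only [hl]
        congr 2
        ring
      · rw [hsplit, ← mul_assoc, ← Real.rpow_add hn0]
        simp only [ht]
        congr 2
        ring
    · refine minimaxRisk_le n _ _ (t n) ?_ ht0.le ?_
      · exact Nat.floor_pos.2 (Real.one_le_rpow hn1 (by linarith))
      · calc t n * (⌊(n : ℝ) ^ (1 + α)⌋₊ : ℝ) ≤ t n * (n : ℝ) ^ (1 + α) := by
              gcongr; exact Nat.floor_le (by positivity)
          _ = (n : ℝ) ^ (-(1 - α - δ)) * n ^ 2 := by
              have htn : t n = (n : ℝ) ^ δ := rfl
              rw [htn, ← Real.rpow_natCast (n : ℝ) 2, ← Real.rpow_add hn0, ← Real.rpow_add hn0]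
              congr 1
              push_cast
              ring
  have hden : ∀ n : ℕ, (n : ℝ) ^ (2 * δ) = t n ^ 2 := by
    intro n
    simp only [ht]
    rw [← Real.rpow_natCast, ← Real.rpow_mul (Nat.cast_nonneg n)]
    congr 1
    push_cast
    ring
  refine tendsto_of_tendsto_of_tendsto_of_le_of_le' hlowT hupT ?_ ?_
  · filter_upwards [hmain] with n ⟨h1, _, ht0, hl0⟩
    rw [hden, le_div_iff₀ (by positivity)]
    set m := t n * ρ n with hm
    have hE : 1 ≤ Real.exp (24 * l n * m ^ 2) := Real.one_le_exp (by positivity)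
    have h2 : Real.exp (-(m ^ 2 / 8) - m - Real.log 12 - 24 * l n * m ^ 2) ≤
        Real.exp (-(m ^ 2 / 8) - m) / (4 * (1 + 2 * Real.exp (24 * l n * m ^ 2))) := by
      rw [le_div_iff₀ (by positivity)]
      calc _ ≤ Real.exp (-(m ^ 2 / 8) - m - Real.log 12 - 24 * l n * m ^ 2) *
            (12 * Real.exp (24 * l n * m ^ 2)) :=
            mul_le_mul_of_nonneg_left (by linarith) (Real.exp_pos _).le
        _ = Real.exp (-(m ^ 2 / 8) - m) := by
            nth_rewrite 2 [← Real.exp_log (show (0 : ℝ) < 12 by norm_num)]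
            rw [← Real.exp_add, ← Real.exp_add]
            congr 1
            ring
    have h3 := Real.log_le_log (Real.exp_pos _) (h2.trans h1)
    rw [Real.log_exp] at h3
    refine le_trans (le_of_eq ?_) h3
    rw [hm]
    field_simp
  · filter_upwards [hmain] with n ⟨h1, h2, ht0, _⟩
    rw [hden, div_le_iff₀ (by positivity)]
    have hpos : 0 < minimaxRisk n ⌊(n : ℝ) ^ (1 + α)⌋₊ (Astar δ α n) :=
      lt_of_lt_of_le (by positivity) h1
    have h3 := Real.log_le_log hpos h2
    rw [Real.log_mul (by norm_num) (Real.exp_pos _).ne', Real.log_exp] at h3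
    refine h3.trans (le_of_eq ?_)
    field_simp
    ring

end
end

section
/- Let α and δ be fixed with 0 < α ≤ 1/2, δ > 0 and α + δ > 1/2, and set A_BI(n) = n^{-(1-α-δ)}. Then lim_{n→∞} (log R_n(A_BI(n))) / n^{2(α+δ)} = −1/8. -/
open MeasureTheory ProbabilityTheory Real Filter Topology

noncomputable section

lemma lintegral_pi_prod {ι : Type*} [Fintype ι] {E : ι → Type*} [∀ i, MeasurableSpace (E i)]
    (μ : ∀ i, Measure (E i)) [∀ i, IsProbabilityMeasure (μ i)]
    (f : ∀ i, E i → ENNReal) (hf : ∀ i, Measurable (f i)) :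
    ∫⁻ x, ∏ i, f i (x i) ∂(Measure.pi μ) = ∏ i, ∫⁻ x, f i x ∂(μ i) := by
  rw [lintegral_prod_eq_prod_lintegral_of_indepFun Finset.univ (fun i (x : ∀ i, E i) => f i (x i))
    (iIndepFun_pi (fun i => (hf i).aemeasurable)) (fun i => (hf i).comp (measurable_pi_apply i))]
  refine Finset.prod_congr rfl fun i _ => ?_
  exact (measurePreserving_eval μ i).lintegral_comp (hf i)

lemma pi_withDensity' {ι : Type*} [Fintype ι] {E : ι → Type*} [∀ i, MeasurableSpace (E i)]
    (μ ν : ∀ i, Measure (E i)) [∀ i, IsProbabilityMeasure (μ i)] [∀ i, IsProbabilityMeasure (ν i)]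
    (f : ∀ i, E i → ENNReal) (hf : ∀ i, Measurable (f i)) (h : ∀ i, ν i = (μ i).withDensity (f i)) :
    Measure.pi ν = (Measure.pi μ).withDensity (fun x => ∏ i, f i (x i)) := by
  refine Measure.pi_eq fun s hs => ?_
  rw [withDensity_apply _ (MeasurableSet.univ_pi hs), ← lintegral_indicator (MeasurableSet.univ_pi hs)]
  have : ∀ x : ∀ i, E i, (Set.univ.pi s).indicator (fun x => ∏ i, f i (x i)) x
      = ∏ i, (s i).indicator (f i) (x i) := by
    intro x
    by_cases hx : x ∈ Set.univ.pi s
    · rw [Set.indicator_of_mem hx]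
      refine Finset.prod_congr rfl fun i _ => ?_
      rw [Set.indicator_of_mem (hx i trivial)]
    · rw [Set.indicator_of_notMem hx]
      simp only [Set.mem_pi, Set.mem_univ, true_implies, not_forall] at hx
      obtain ⟨i, hi⟩ := hx
      exact (Finset.prod_eq_zero (Finset.mem_univ i) (Set.indicator_of_notMem hi _)).symm
  simp_rw [this]
  rw [lintegral_pi_prod μ _ (fun i => (hf i).indicator (hs i))]
  refine Finset.prod_congr rfl fun i _ => ?_
  rw [lintegral_indicator (hs i), h, withDensity_apply _ (hs i)]

lemma gaussian_shift (m s : ℝ) : gaussianReal (m + s) 1 =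
    (gaussianReal m 1).withDensity (fun x => ENNReal.ofReal (rexp (s * (x - m) - s ^ 2 / 2))) := by
  rw [gaussianReal_of_var_ne_zero _ one_ne_zero, gaussianReal_of_var_ne_zero _ one_ne_zero,
    ← withDensity_mul _ (measurable_gaussianPDF _ _) (by fun_prop)]
  congr 1
  ext x
  simp only [gaussianPDF, Pi.mul_apply, gaussianPDFReal]
  rw [← ENNReal.ofReal_mul (by positivity), mul_assoc (√(2 * π * _))⁻¹, ← Real.exp_add]
  congr 3
  push_cast
  ring

instance (N : ℕ) (θ : Fin N → Fin N → ℝ) : IsProbabilityMeasure (PTheta N θ) := by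
  unfold PTheta; infer_instance

/-- log-density -/
def logD (N : ℕ) (θ s x : Fin N → Fin N → ℝ) : ℝ :=
  ∑ i, ∑ j, (s i j * (x i j - θ i j) - s i j ^ 2 / 2)

lemma measurable_logD (N : ℕ) (θ s : Fin N → Fin N → ℝ) : Measurable (logD N θ s) := by
  unfold logD; fun_prop

lemma PTheta_shift (N : ℕ) (θ s : Fin N → Fin N → ℝ) : PTheta N (θ + s) =
    (PTheta N θ).withDensity (fun x => ENNReal.ofReal (rexp (logD N θ s x))) := by
  unfold PTheta
  rw [pi_withDensity' (fun i => Measure.pi fun j => gaussianReal (θ i j) 1) _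
    (fun i x => ∏ j, ENNReal.ofReal (rexp (s i j * (x j - θ i j) - s i j ^ 2 / 2)))
    (fun i => by fun_prop)]
  · congr 1
    ext x
    simp only [logD, Real.exp_sum]
    rw [ENNReal.ofReal_prod_of_nonneg (fun i _ => by positivity)]
    refine Finset.prod_congr rfl fun i _ => ?_
    rw [ENNReal.ofReal_prod_of_nonneg (fun i _ => by positivity)]
  · intro i
    exact pi_withDensity' _ _ (fun j y => ENNReal.ofReal (rexp (s i j * (y - θ i j) - s i j ^ 2 / 2)))
      (fun i => by fun_prop) (fun j => gaussian_shift _ _)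

lemma chernoff_s2 (N : ℕ) (θ s : Fin N → Fin N → ℝ) (t : ℝ) :
    (PTheta N θ {x | t ≤ logD N θ s x}).toReal ≤ rexp (-t) := by
  have h1 : ∫⁻ x, ENNReal.ofReal (rexp (logD N θ s x)) ∂(PTheta N θ) = 1 := by
    rw [← setLIntegral_univ, ← withDensity_apply _ MeasurableSet.univ, ← PTheta_shift,
      measure_univ]
  have h2 := mul_meas_ge_le_lintegral (μ := PTheta N θ)
    (f := fun x => ENNReal.ofReal (rexp (logD N θ s x)))
    (by have := measurable_logD N θ s; fun_prop) (ENNReal.ofReal (rexp t))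
  rw [h1] at h2
  have h3 : {x | ENNReal.ofReal (rexp t) ≤ ENNReal.ofReal (rexp (logD N θ s x))}
      = {x | t ≤ logD N θ s x} := by
    ext x
    simp [ENNReal.ofReal_le_ofReal_iff (Real.exp_nonneg _)]
  rw [h3] at h2
  have h4 := ENNReal.toReal_mono (by simp) h2
  rw [ENNReal.toReal_mul, ENNReal.toReal_ofReal (by positivity), ENNReal.toReal_one] at h4
  rw [Real.exp_neg, ← one_div, le_div_iff₀ (by positivity), mul_comm]
  exact h4

lemma chernoff' (N : ℕ) (θ s : Fin N → Fin N → ℝ) (t : ℝ) (S : Set (Fin N → Fin N → ℝ))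
    (h : ∀ x ∈ S, t ≤ logD N θ s x) : (PTheta N θ S).toReal ≤ rexp (-t) :=
  le_trans (ENNReal.toReal_mono (measure_ne_top _ _) (measure_mono h)) (chernoff_s2 N θ s t)

lemma PTheta_ge (N : ℕ) (θ s : Fin N → Fin N → ℝ) (t : ℝ) (T E : Set (Fin N → Fin N → ℝ))
    (hT : MeasurableSet T) (h : ∀ x ∈ E, -t ≤ logD N θ s x) :
    rexp (-t) * (PTheta N θ (T ∩ E)).toReal ≤ (PTheta N (θ + s) T).toReal := by
  rw [← ENNReal.toReal_ofReal (Real.exp_nonneg (-t)), ← ENNReal.toReal_mul]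
  refine ENNReal.toReal_mono (measure_ne_top _ _) ?_
  rw [PTheta_shift, withDensity_apply _ hT]
  have hm : Measurable fun x => ENNReal.ofReal (rexp (logD N θ s x)) := by
    have := measurable_logD N θ s; fun_prop
  have h2 := mul_meas_ge_le_lintegral (μ := (PTheta N θ).restrict T) hm (ENNReal.ofReal (rexp (-t)))
  refine le_trans ?_ h2
  refine mul_le_mul_right ?_ _
  rw [Measure.restrict_apply' hT]
  refine measure_mono ?_
  rintro x ⟨hx, hxE⟩
  exact ⟨ENNReal.ofReal_le_ofReal (Real.exp_le_exp.2 (h x hxE)), hx⟩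

/-- constant block -/
def blk (N : ℕ) (R C : Finset (Fin N)) (c : ℝ) : Fin N → Fin N → ℝ :=
  fun i j => if i ∈ R ∧ j ∈ C then c else 0

lemma logD_blk (N : ℕ) (R C : Finset (Fin N)) (c : ℝ) (θ x : Fin N → Fin N → ℝ) :
    logD N θ (blk N R C c) x =
      c * ∑ i ∈ R, ∑ j ∈ C, (x i j - θ i j) - R.card * C.card * (c ^ 2 / 2) := by
  have h : ∀ i j, (blk N R C c i j * (x i j - θ i j) - blk N R C c i j ^ 2 / 2) =
      if i ∈ R then (if j ∈ C then (c * (x i j - θ i j) - c ^ 2 / 2) else 0) else 0 := by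
    intro i j
    unfold blk
    by_cases h1 : i ∈ R <;> by_cases h2 : j ∈ C <;> simp [h1, h2]
  simp only [logD, h, Finset.sum_ite_irrel, Finset.sum_const_zero, Finset.sum_ite_mem,
    Finset.univ_inter, Finset.sum_sub_distrib, Finset.sum_const, ← Finset.mul_sum, nsmul_eq_mul]
  ring

lemma sum_ge (N n : ℕ) (R C : Finset (Fin N)) (hR : R.card = n) (hC : C.card = n) (A : ℝ)
    (θ : Fin N → Fin N → ℝ) (h : ∀ i j, i ∈ R → j ∈ C → A ≤ θ i j) :
    (n : ℝ) ^ 2 * A ≤ ∑ i ∈ R, ∑ j ∈ C, θ i j := by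
  have : ∑ i ∈ R, ∑ j ∈ C, A ≤ ∑ i ∈ R, ∑ j ∈ C, θ i j :=
    Finset.sum_le_sum fun i hi => Finset.sum_le_sum fun j hj => h i j hi hj
  simp only [Finset.sum_const, hR, hC, nsmul_eq_mul] at this
  linarith

lemma bdd_typeII (n N : ℕ) (A : ℝ) (T : Set (Fin N → Fin N → ℝ)) :
    BddAbove (Set.range fun θ : ThetaSet A n N => (PTheta N θ.1 T).toReal) := by
  refine ⟨1, ?_⟩
  rintro _ ⟨θ, rfl⟩
  exact ENNReal.toReal_le_of_le_ofReal zero_le_one (by simpa using prob_le_one)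

lemma risk_upper (n N : ℕ) (A : ℝ) (hA : 0 < A) :
    minimaxRisk n N A ≤ ((N : ℝ) ^ n * (N : ℝ) ^ n + 1) * rexp (-((n : ℝ) ^ 2 * A ^ 2 / 8)) := by
  classical
  set P := Finset.powersetCard n (Finset.univ : Finset (Fin N)) with hP
  let S : Finset (Fin N) × Finset (Fin N) → Set (Fin N → Fin N → ℝ) := fun p =>
    {x | (n : ℝ) ^ 2 * A / 2 ≤ ∑ i ∈ p.1, ∑ j ∈ p.2, x i j}
  let T : Set (Fin N → Fin N → ℝ) := ⋃ p ∈ P ×ˢ P, S p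
  have hT : MeasurableSet T := by
    refine Finset.measurableSet_biUnion _ fun p _ => ?_
    exact measurableSet_le measurable_const (by fun_prop)
  have hle : minimaxRisk n N A ≤ testRisk n N A T :=
    ciInf_le (f := fun T : {T : Set (Fin N → Fin N → ℝ) // MeasurableSet T} => testRisk n N A T.1)
      ⟨0, by rintro _ ⟨T, rfl⟩; exact testRisk_nonneg _ _ _ _⟩ ⟨T, hT⟩
  refine hle.trans ?_
  unfold testRisk
  rw [add_mul, one_mul]
  refine add_le_add ?_ ?_
  · have h1 : (PTheta N 0 T).toReal ≤ ∑ p ∈ P ×ˢ P, (PTheta N 0 (S p)).toReal := by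
      rw [← ENNReal.toReal_sum (fun _ _ => measure_ne_top _ _)]
      exact ENNReal.toReal_mono (by simp [ENNReal.sum_eq_top]) (measure_biUnion_finset_le _ _)
    have h2 : ∀ p ∈ P ×ˢ P, (PTheta N 0 (S p)).toReal ≤ rexp (-((n : ℝ) ^ 2 * A ^ 2 / 8)) := by
      intro p hp
      simp only [Finset.mem_product, hP, Finset.mem_powersetCard_univ] at hp
      refine chernoff' N 0 (blk N p.1 p.2 (A / 2)) _ _ fun x hx => ?_
      rw [logD_blk, hp.1, hp.2]
      simp only [S, Set.mem_ofPred_eq] at hx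
      simp only [Pi.zero_apply, sub_zero]
      have := mul_le_mul_of_nonneg_left hx (by positivity : 0 ≤ A / 2)
      nlinarith
    refine h1.trans ((Finset.sum_le_sum h2).trans ?_)
    rw [Finset.sum_const, nsmul_eq_mul]
    refine mul_le_mul_of_nonneg_right ?_ (Real.exp_nonneg _)
    rw [Finset.card_product, hP, Finset.card_powersetCard, Finset.card_univ, Fintype.card_fin]
    exact_mod_cast Nat.mul_le_mul (Nat.choose_le_pow _ _) (Nat.choose_le_pow _ _)
  · refine Real.iSup_le ?_ (Real.exp_nonneg _)
    rintro ⟨θ, R, C, hR, hC, h1, h2⟩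
    refine chernoff' N θ (blk N R C (-(A / 2))) _ _ fun x hx => ?_
    have hx' : x ∉ S (R, C) := by
      intro hx'
      refine hx (Set.mem_biUnion (x := (R, C)) ?_ hx')
      simp [hP, hR, hC]
    simp only [S, Set.mem_ofPred_eq, not_le] at hx'
    rw [logD_blk, hR, hC]
    simp only [Finset.sum_sub_distrib]
    have h3 := sum_ge N n R C hR hC A θ h1
    nlinarith

lemma risk_lower (n N : ℕ) (A : ℝ) (hA : 0 < A) (hn : 1 ≤ n) (hN : n ≤ N) :
    rexp (-(n * A + (n : ℝ) ^ 2 * A ^ 2 / 8)) / 2 ≤ minimaxRisk n N A := by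
  obtain ⟨R, -, hR⟩ := Finset.exists_subset_card_eq (s := (Finset.univ : Finset (Fin N))) (n := n)
    (by simpa using hN)
  have hn0 : (0 : ℝ) < n := by exact_mod_cast hn
  have : Nonempty {T : Set (Fin N → Fin N → ℝ) // MeasurableSet T} := ⟨⟨∅, MeasurableSet.empty⟩⟩
  refine le_ciInf ?_
  rintro ⟨T, hT⟩
  show _ ≤ testRisk n N A T
  have hmem : blk N R R A ∈ ThetaSet A n N := by
    refine ⟨R, R, hR, hR, ?_, ?_⟩
    · intro i j hi hj
      simp [blk, hi, hj]
    · intro i j hij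
      simp only [blk, if_neg hij]
  have h1 : (PTheta N (blk N R R A) Tᶜ).toReal ≤ ⨆ θ : ThetaSet A n N, (PTheta N θ.1 Tᶜ).toReal :=
    le_ciSup (bdd_typeII n N A Tᶜ) ⟨_, hmem⟩
  set θ := blk N R R (A / 2) with hθ
  have e0 : (0 : Fin N → Fin N → ℝ) = θ + blk N R R (-(A / 2)) := by
    ext i j
    simp only [hθ, blk, Pi.add_apply, Pi.zero_apply]
    split_ifs <;> ring
  have e1 : blk N R R A = θ + blk N R R (A / 2) := by
    ext i j
    simp only [hθ, blk, Pi.add_apply]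
    split_ifs <;> ring
  let Y : (Fin N → Fin N → ℝ) → ℝ := fun x => ∑ i ∈ R, ∑ j ∈ R, (x i j - θ i j)
  let E : Set (Fin N → Fin N → ℝ) := {x | |Y x| ≤ 2 * n}
  have hE : MeasurableSet E := measurableSet_le (by fun_prop) measurable_const
  set t := n * A + (n : ℝ) ^ 2 * A ^ 2 / 8 with ht
  have g0 : rexp (-t) * (PTheta N θ (T ∩ E)).toReal ≤ (PTheta N 0 T).toReal := by
    rw [e0]
    refine PTheta_ge N θ _ t T E hT fun x hx => ?_
    rw [logD_blk, hR]
    have := abs_le.1 (show |Y x| ≤ 2 * n from hx)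
    show _ ≤ -(A / 2) * Y x - _
    nlinarith
  have g1 : rexp (-t) * (PTheta N θ (Tᶜ ∩ E)).toReal ≤ (PTheta N (blk N R R A) Tᶜ).toReal := by
    rw [e1]
    refine PTheta_ge N θ _ t Tᶜ E hT.compl fun x hx => ?_
    rw [logD_blk, hR]
    have := abs_le.1 (show |Y x| ≤ 2 * n from hx)
    show _ ≤ (A / 2) * Y x - _
    nlinarith
  have c1 : (PTheta N θ {x | 2 * n ≤ Y x}).toReal ≤ rexp (-2) := by
    refine chernoff' N θ (blk N R R (2 / n)) 2 _ fun x hx => ?_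
    rw [logD_blk, hR]
    show _ ≤ 2 / (n : ℝ) * Y x - _
    have := mul_le_mul_of_nonneg_left (show 2 * (n : ℝ) ≤ Y x from hx) (by positivity : 0 ≤ 2 / (n : ℝ))
    field_simp at this ⊢
    linarith
  have c2 : (PTheta N θ {x | Y x ≤ -(2 * n)}).toReal ≤ rexp (-2) := by
    refine chernoff' N θ (blk N R R (-(2 / n))) 2 _ fun x hx => ?_
    rw [logD_blk, hR]
    show _ ≤ -(2 / (n : ℝ)) * Y x - _
    have := mul_le_mul_of_nonneg_left (show Y x ≤ -(2 * (n : ℝ)) from hx)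
      (by positivity : 0 ≤ 2 / (n : ℝ))
    field_simp at this ⊢
    linarith
  have e2 : rexp (-2) ≤ 1 / 4 := by
    have h := Real.add_one_le_exp (1 : ℝ)
    rw [show (-2 : ℝ) = -(1 + 1) by norm_num, Real.exp_neg, Real.exp_add, ← one_div]
    exact one_div_le_one_div_of_le (by norm_num) (by nlinarith)
  have hsum : (PTheta N θ (T ∩ E)).toReal + (PTheta N θ (Tᶜ ∩ E)).toReal
      = (PTheta N θ E).toReal := by
    rw [← ENNReal.toReal_add (measure_ne_top _ _) (measure_ne_top _ _), Set.inter_comm T,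
      Set.inter_comm Tᶜ, ← Set.sdiff_eq, measure_inter_add_sdiff _ hT]
  have hEc : 1 / 2 ≤ (PTheta N θ E).toReal := by
    have k1 : (PTheta N θ E).toReal + (PTheta N θ Eᶜ).toReal = 1 := by
      rw [← ENNReal.toReal_add (measure_ne_top _ _) (measure_ne_top _ _),
        measure_add_measure_compl hE, measure_univ, ENNReal.toReal_one]
    have k2 : (PTheta N θ Eᶜ).toReal ≤ (PTheta N θ {x | 2 * n ≤ Y x}).toReal
        + (PTheta N θ {x | Y x ≤ -(2 * n)}).toReal := by
      rw [← ENNReal.toReal_add (measure_ne_top _ _) (measure_ne_top _ _)]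
      refine ENNReal.toReal_mono (by simp) (le_trans (measure_mono ?_) (measure_union_le _ _))
      intro x hx
      have hx' : 2 * (n : ℝ) < |Y x| := not_le.1 hx
      rcases lt_abs.1 hx' with h | h
      · exact Or.inl h.le
      · exact Or.inr (by show Y x ≤ _; linarith)
    linarith
  unfold testRisk
  nlinarith [Real.exp_pos (-t)]

/-- **Sparse above-boundary regime, part 2.**  For fixed 0 < α ≤ 1/2, δ > 0 with
α + δ > 1/2, and `A_BI(n) = n^{-(1-α-δ)}`, `N = ⌊n^{1+α}⌋`, the minimax risk satisfies
`log R_n(A_BI(n)) / n^{2(α+δ)} → -1/8`. -/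
theorem sparse_above_boundary_BI (α δ : ℝ) (hα : 0 < α) (hα' : α ≤ 1 / 2) (hδ : 0 < δ)
    (hαδ : 1 / 2 < α + δ) :
    Tendsto (fun n : ℕ =>
        Real.log (minimaxRisk n ⌊(n : ℝ) ^ (1 + α)⌋₊ ((n : ℝ) ^ (-(1 - α - δ)))) /
          (n : ℝ) ^ (2 * (α + δ)))
      atTop (𝓝 (-1 / 8)) := by
  set β := α + δ with hβ
  have t1 : Tendsto (fun n : ℕ => (n : ℝ) ^ (-β)) atTop (𝓝 0) :=
    (tendsto_rpow_neg_atTop (by linarith)).comp tendsto_natCast_atTop_atTop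
  have t2 : Tendsto (fun n : ℕ => (n : ℝ) ^ (-(2 * β))) atTop (𝓝 0) :=
    (tendsto_rpow_neg_atTop (by linarith)).comp tendsto_natCast_atTop_atTop
  have t3 : Tendsto (fun n : ℕ => Real.log n / (n : ℝ) ^ (2 * β - 1)) atTop (𝓝 0) :=
    ((isLittleO_log_rpow_atTop (by linarith)).tendsto_div_nhds_zero).comp
      tendsto_natCast_atTop_atTop
  have lo : Tendsto (fun n : ℕ => -(n : ℝ) ^ (-β) - 1 / 8 - Real.log 2 * (n : ℝ) ^ (-(2 * β)))
      atTop (𝓝 (-1 / 8)) := by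
    have := ((t1.neg).sub_const (1 / 8)).sub (t2.const_mul (Real.log 2))
    convert this using 2; norm_num
  have up : Tendsto (fun n : ℕ => Real.log 2 * (n : ℝ) ^ (-(2 * β))
      + 2 * (1 + α) * (Real.log n / (n : ℝ) ^ (2 * β - 1)) - 1 / 8) atTop (𝓝 (-1 / 8)) := by
    have := ((t2.const_mul (Real.log 2)).add (t3.const_mul (2 * (1 + α)))).sub_const (1 / 8)
    convert this using 2; norm_num
  have key : ∀ n : ℕ, 1 ≤ n → ∀ N : ℕ, N = ⌊(n : ℝ) ^ (1 + α)⌋₊ → ∀ A : ℝ,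
      A = (n : ℝ) ^ (-(1 - α - δ)) → 0 < A ∧ n ≤ N ∧ n * A = (n : ℝ) ^ β ∧
      (n : ℝ) ^ 2 * A ^ 2 = (n : ℝ) ^ (2 * β) ∧ Real.log N ≤ (1 + α) * Real.log n := by
    intro n hn N hN A hA
    have hn1 : (1 : ℝ) ≤ n := by exact_mod_cast hn
    have hn0 : (0 : ℝ) < n := by linarith
    have hnA : n * A = (n : ℝ) ^ β := by
      rw [hA]
      nth_rewrite 1 [← Real.rpow_one (n : ℝ)]
      rw [← Real.rpow_add hn0]
      congr 1; rw [hβ]; ring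
    have hnN : n ≤ N := by
      rw [hN]
      refine Nat.le_floor ?_
      nth_rewrite 1 [← Real.rpow_one (n : ℝ)]
      exact Real.rpow_le_rpow_of_exponent_le hn1 (by linarith)
    refine ⟨hA ▸ Real.rpow_pos_of_pos hn0 _, hnN, hnA, ?_, ?_⟩
    · rw [← mul_pow, hnA, ← Real.rpow_natCast, ← Real.rpow_mul hn0.le]
      congr 1; push_cast; ring
    · rw [← Real.log_rpow hn0]
      refine Real.log_le_log (by exact_mod_cast (by omega : 0 < N)) ?_
      rw [hN]
      exact Nat.floor_le (by positivity)
  refine tendsto_of_tendsto_of_tendsto_of_le_of_le' lo up ?_ ?_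
  · filter_upwards [eventually_ge_atTop 1] with n hn
    obtain ⟨hA, hnN, e1, e2, e3⟩ := key n hn _ rfl _ rfl
    set N := ⌊(n : ℝ) ^ (1 + α)⌋₊
    set A := (n : ℝ) ^ (-(1 - α - δ))
    have hn0 : (0 : ℝ) < n := by exact_mod_cast hn
    have h := Real.log_le_log (by positivity) (risk_lower n N A hA hn hnN)
    rw [Real.log_div (by positivity) (by norm_num), Real.log_exp, e1, e2] at h
    have hp : 0 < (n : ℝ) ^ (2 * β) := Real.rpow_pos_of_pos hn0 _
    rw [le_div_iff₀ hp]
    refine le_trans (le_of_eq ?_) h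
    have a1 : (n : ℝ) ^ (-β) * (n : ℝ) ^ (2 * β) = (n : ℝ) ^ β := by
      rw [← Real.rpow_add hn0]; congr 1; ring
    have a2 : (n : ℝ) ^ (-(2 * β)) * (n : ℝ) ^ (2 * β) = 1 := by
      rw [← Real.rpow_add hn0]; simp
    linear_combination -a1 - Real.log 2 * a2
  · filter_upwards [eventually_ge_atTop 1] with n hn
    obtain ⟨hA, hnN, e1, e2, e3⟩ := key n hn _ rfl _ rfl
    set N := ⌊(n : ℝ) ^ (1 + α)⌋₊
    set A := (n : ℝ) ^ (-(1 - α - δ))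
    have hn0 : (0 : ℝ) < n := by exact_mod_cast hn
    have hN1 : (1 : ℝ) ≤ N := by exact_mod_cast hn.trans hnN
    have hpos : 0 < minimaxRisk n N A :=
      lt_of_lt_of_le (by positivity) (risk_lower n N A hA hn hnN)
    have hb : minimaxRisk n N A ≤ 2 * (N : ℝ) ^ (2 * n) * rexp (-((n : ℝ) ^ 2 * A ^ 2 / 8)) := by
      refine (risk_upper n N A hA).trans (mul_le_mul_of_nonneg_right ?_ (Real.exp_nonneg _))
      rw [← pow_add, ← two_mul]
      have := one_le_pow₀ hN1 (n := 2 * n)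
      linarith
    have h := Real.log_le_log hpos hb
    rw [Real.log_mul (by positivity) (by positivity), Real.log_mul (by positivity) (by positivity),
      Real.log_exp, Real.log_pow, e2] at h
    have hp : 0 < (n : ℝ) ^ (2 * β) := Real.rpow_pos_of_pos hn0 _
    rw [div_le_iff₀ hp]
    refine h.trans ?_
    have a2 : (n : ℝ) ^ (-(2 * β)) * (n : ℝ) ^ (2 * β) = 1 := by
      rw [← Real.rpow_add hn0]; simp
    have a3 : (Real.log n / (n : ℝ) ^ (2 * β - 1)) * (n : ℝ) ^ (2 * β) = n * Real.log n := by
      rw [Real.rpow_sub hn0, Real.rpow_one]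
      field_simp
    have a4 := mul_le_mul_of_nonneg_left e3 hn0.le
    push_cast
    have a5 : (Real.log 2 * (n : ℝ) ^ (-(2 * β))
      + 2 * (1 + α) * (Real.log n / (n : ℝ) ^ (2 * β - 1)) - 1 / 8) * (n : ℝ) ^ (2 * β)
      = Real.log 2 + 2 * (1 + α) * (n * Real.log n) - (n : ℝ) ^ (2 * β) / 8 := by
      linear_combination Real.log 2 * a2 + 2 * (1 + α) * a3
    rw [a5]
    nlinarith

end
end
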